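/- arXiv:0801.4605 — 6 statements merged into one kernel-verified Lean document; each statement's English description precedes it below -/
import Mathlib

section
/- Let τ : A → ℂ be a linear functional with τ(1) = 1 such that τ(xy) = τ(yx) whenever x = S_α S_β* and y = S_γ S_δ* are monomials with |α| = |β| and |γ| = |δ|. Then for all words μ, ν with |μ| = |ν| one has τ(S_μ S_ν*) = n^{-|μ|} if μ = ν, and τ(S_μ S_ν*) = 0 if μ ≠ ν. -/
/-- The product `S_μ = S_{μ₁} ⋯ S_{μ_k}` of a Cuntz family along a word `μ`. -/
def cuntzWord {A : Type*} [Monoid A] {n : ℕ} (S : Fin n → A) (w : List (Fin n)) : A :=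
  (w.map S).prod

theorem cuntzWord_star_mul {A : Type*} [Ring A] [StarRing A] {n : ℕ} {S : Fin n → A}
    (hS : ∀ i j, star (S i) * S j = if i = j then 1 else 0) :
    ∀ μ ν : List (Fin n), μ.length = ν.length →
      star (cuntzWord S μ) * cuntzWord S ν = if μ = ν then 1 else 0
  | [], [], _ => by simp [cuntzWord]
  | i :: μ, j :: ν, h => by
    have ih := cuntzWord_star_mul hS μ ν (by simpa using h)
    have key : star (cuntzWord S (i :: μ)) * cuntzWord S (j :: ν)
        = star (cuntzWord S μ) * (star (S i) * S j) * cuntzWord S ν := by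
      simp [cuntzWord, mul_assoc]
    rw [key, hS]
    by_cases hij : i = j <;> simp [hij, ih]

theorem cuntzWord_mul_star_eq_sum {A : Type*} [Ring A] [StarRing A] {n : ℕ} {S : Fin n → A}
    (hS : ∑ i, S i * star (S i) = 1) (μ : List (Fin n)) :
    cuntzWord S μ * star (cuntzWord S μ)
      = ∑ i, cuntzWord S (μ ++ [i]) * star (cuntzWord S (μ ++ [i])) := by
  have key (i : Fin n) : cuntzWord S (μ ++ [i]) * star (cuntzWord S (μ ++ [i]))
      = cuntzWord S μ * (S i * star (S i)) * star (cuntzWord S μ) := by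
    simp [cuntzWord, mul_assoc]
  simp_rw [key]
  rw [← Finset.sum_mul, ← Finset.mul_sum, hS, mul_one]

/-- a linear functional `τ` with `τ 1 = 1` that is tracial on the monomials
`S_μ S_ν^*` of degree zero takes the value `n^{-|μ|} δ_{μν}` on such monomials. -/
theorem stmt_0 {A : Type*} [Ring A] [Algebra ℂ A] [StarRing A] [StarModule ℂ A]
    {n : ℕ} (hn : 2 ≤ n) (S : Fin n → A)
    (hS1 : ∀ i j, star (S i) * S j = if i = j then 1 else 0)
    (hS2 : ∑ i, S i * star (S i) = 1)
    (τ : A →ₗ[ℂ] ℂ) (hτ1 : τ 1 = 1)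
    (htr : ∀ α β γ δ : List (Fin n), α.length = β.length → γ.length = δ.length →
      τ (cuntzWord S α * star (cuntzWord S β) * (cuntzWord S γ * star (cuntzWord S δ)))
        = τ (cuntzWord S γ * star (cuntzWord S δ) * (cuntzWord S α * star (cuntzWord S β)))) :
    ∀ μ ν : List (Fin n), μ.length = ν.length →
      τ (cuntzWord S μ * star (cuntzWord S ν))
        = if μ = ν then (n : ℂ) ^ (-(μ.length : ℤ)) else 0 := by
  have orth := cuntzWord_star_mul hS1
  have diag (μ ν : List (Fin n)) (h : μ.length = ν.length) :
      τ (cuntzWord S μ * star (cuntzWord S μ)) = τ (cuntzWord S ν * star (cuntzWord S ν)) := by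
    have contract (α β : List (Fin n)) :
        cuntzWord S α * star (cuntzWord S β) * (cuntzWord S β * star (cuntzWord S α))
          = cuntzWord S α * star (cuntzWord S α) := by
      rw [mul_assoc, ← mul_assoc (star _), orth β β rfl, if_pos rfl, one_mul]
    simpa only [contract] using htr μ ν ν μ h h.symm
  have hn0 : (n : ℂ) ≠ 0 := by
    exact_mod_cast (by omega : n ≠ 0)
  have value (μ : List (Fin n)) :
      τ (cuntzWord S μ * star (cuntzWord S μ)) = (n : ℂ) ^ (-(μ.length : ℤ)) := by
    induction μ using List.reverseRecOn with
    | nil => simp [cuntzWord, hτ1]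
    | append_singleton μ i ih =>
      rw [cuntzWord_mul_star_eq_sum hS2, map_sum,
        Finset.sum_congr rfl fun j _ => diag (μ ++ [j]) (μ ++ [i]) (by simp)] at ih
      simp only [Finset.sum_const, Finset.card_univ, Fintype.card_fin, nsmul_eq_mul] at ih
      apply mul_left_cancel₀ hn0
      rw [ih, ← zpow_one_add₀ hn0]
      congr 1
      simp
  intro μ ν h
  split_ifs with hμν
  · rw [← hμν, value]
  · have hcomm := htr μ ν ν ν h rfl
    rw [mul_assoc, ← mul_assoc (star _), orth ν ν rfl, if_pos rfl, one_mul,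
      mul_assoc, ← mul_assoc (star _), orth ν μ h.symm, if_neg (Ne.symm hμν), zero_mul,
      mul_zero, map_zero] at hcomm
    exact hcomm
end

section
/- For all words α, β, μ, ν one has ψ(S_α S_β* · S_μ S_ν*) = n^{|μ|−|ν|} · ψ(S_μ S_ν* · S_α S_β*). (This is the KMS/adjoint identity ⟨S(a)|b⟩ = ⟨F(b)|a⟩ for the state ψ on the Cuntz algebra.) -/
section CuntzFamily

variable {A : Type*} {n : ℕ}

theorem cuntzWord_cons [Monoid A] (S : Fin n → A) (i : Fin n) (w : List (Fin n)) :
    cuntzWord S (i :: w) = S i * cuntzWord S w := by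
  simp [cuntzWord]

theorem cuntzWord_append [Monoid A] (S : Fin n → A) (v w : List (Fin n)) :
    cuntzWord S (v ++ w) = cuntzWord S v * cuntzWord S w := by
  simp [cuntzWord]

variable [Ring A] [StarRing A] {S : Fin n → A}

theorem star_cuntzWord_cons_mul_cons
    (hS : ∀ i j, star (S i) * S j = if i = j then 1 else 0)
    (i j : Fin n) (v w : List (Fin n)) :
    star (cuntzWord S (i :: v)) * cuntzWord S (j :: w)
      = if i = j then star (cuntzWord S v) * cuntzWord S w else 0 := by
  rw [cuntzWord_cons, cuntzWord_cons, star_mul, mul_assoc, ← mul_assoc (star (S i)), hS]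
  split_ifs <;> simp

theorem star_cuntzWord_mul_self
    (hS : ∀ i j, star (S i) * S j = if i = j then 1 else 0) (w : List (Fin n)) :
    star (cuntzWord S w) * cuntzWord S w = 1 := by
  induction w with
  | nil => simp [cuntzWord]
  | cons i w ih => rw [star_cuntzWord_cons_mul_cons hS, if_pos rfl, ih]

theorem star_cuntzWord_mul_append
    (hS : ∀ i j, star (S i) * S j = if i = j then 1 else 0) (v w : List (Fin n)) :
    star (cuntzWord S v) * cuntzWord S (v ++ w) = cuntzWord S w := by
  rw [cuntzWord_append, ← mul_assoc, star_cuntzWord_mul_self hS, one_mul]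

theorem star_cuntzWord_append_mul
    (hS : ∀ i j, star (S i) * S j = if i = j then 1 else 0) (v w : List (Fin n)) :
    star (cuntzWord S (v ++ w)) * cuntzWord S v = star (cuntzWord S w) := by
  rw [cuntzWord_append, star_mul, mul_assoc, star_cuntzWord_mul_self hS, mul_one]

theorem star_cuntzWord_mul_eq_zero
    (hS : ∀ i j, star (S i) * S j = if i = j then 1 else 0) {v w : List (Fin n)}
    (hvw : ¬ v <+: w) (hwv : ¬ w <+: v) :
    star (cuntzWord S v) * cuntzWord S w = 0 := by
  induction v generalizing w with
  | nil => exact absurd (List.nil_prefix) hvw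
  | cons i v ih =>
    cases w with
    | nil => exact absurd (List.nil_prefix) hwv
    | cons j w =>
      rw [star_cuntzWord_cons_mul_cons hS]
      split_ifs with hij
      · subst hij
        rw [List.cons_prefix_cons] at hvw hwv
        exact ih (fun h => hvw ⟨rfl, h⟩) (fun h => hwv ⟨rfl, h⟩)
      · rfl

open Classical in
/-- The product of `S_α S_β^*` and `S_μ S_ν^*` has nonzero `ψ`-value exactly when one of the
pairs `(β, α)`, `(μ, ν)` arises from the other by appending a common suffix. -/
theorem map_cuntzWord_mul_star_mul [Algebra ℂ A]
    (hS : ∀ i j, star (S i) * S j = if i = j then 1 else 0) (ψ : A →ₗ[ℂ] ℂ)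
    (hψ : ∀ μ ν : List (Fin n), ψ (cuntzWord S μ * star (cuntzWord S ν))
      = if μ = ν then (n : ℂ) ^ (-(μ.length : ℤ)) else 0) (α β μ ν : List (Fin n)) :
    ψ (cuntzWord S α * star (cuntzWord S β) * (cuntzWord S μ * star (cuntzWord S ν)))
      = if ∃ γ, (μ = β ++ γ ∧ ν = α ++ γ) ∨ (β = μ ++ γ ∧ α = ν ++ γ)
        then (n : ℂ) ^ (-(max α.length ν.length : ℤ)) else 0 := by
  rw [mul_assoc, ← mul_assoc (star (cuntzWord S β))]
  by_cases hβμ : β <+: μ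
  · obtain ⟨γ, rfl⟩ := hβμ
    rw [star_cuntzWord_mul_append hS, ← mul_assoc, ← cuntzWord_append, hψ]
    have hiff : (∃ δ, (β ++ γ = β ++ δ ∧ ν = α ++ δ) ∨ (β = β ++ γ ++ δ ∧ α = ν ++ δ))
        ↔ α ++ γ = ν := by
      constructor
      · rintro ⟨δ, ⟨h, rfl⟩ | ⟨h, rfl⟩⟩
        · rw [List.append_cancel_left h]
        · rw [List.append_assoc, List.self_eq_append_right, List.append_eq_nil_iff] at h
          simp [h]
      · rintro rfl
        exact ⟨γ, .inl ⟨rfl, rfl⟩⟩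
    simp only [hiff]
    split_ifs with h
    · subst h
      simp
    · rfl
  by_cases hμβ : μ <+: β
  · obtain ⟨γ, rfl⟩ := hμβ
    rw [star_cuntzWord_append_mul hS, ← star_mul, ← cuntzWord_append, hψ]
    have hiff : (∃ δ, (μ = μ ++ γ ++ δ ∧ ν = α ++ δ) ∨ (μ ++ γ = μ ++ δ ∧ α = ν ++ δ))
        ↔ α = ν ++ γ := by
      constructor
      · rintro ⟨δ, ⟨h, rfl⟩ | ⟨h, rfl⟩⟩
        · rw [List.append_assoc, List.self_eq_append_right, List.append_eq_nil_iff] at h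
          simp [h]
        · rw [List.append_cancel_left h]
      · rintro rfl
        exact ⟨γ, .inr ⟨rfl, rfl⟩⟩
    simp only [hiff]
    split_ifs with h
    · subst h
      simp
    · rfl
  · rw [star_cuntzWord_mul_eq_zero hS hβμ hμβ, if_neg]
    · simp
    · rintro ⟨γ, ⟨rfl, -⟩ | ⟨rfl, -⟩⟩
      · exact hβμ (List.prefix_append _ _)
      · exact hμβ (List.prefix_append _ _)

end CuntzFamily

/-- the KMS/adjoint identity
`ψ(S_α S_β^* ⬝ S_μ S_ν^*) = n^{|μ|-|ν|} ψ(S_μ S_ν^* ⬝ S_α S_β^*)`. -/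
theorem stmt_1 {A : Type*} [Ring A] [Algebra ℂ A] [StarRing A] [StarModule ℂ A]
    {n : ℕ} (hn : 2 ≤ n) (S : Fin n → A)
    (hS1 : ∀ i j, star (S i) * S j = if i = j then 1 else 0)
    (hS2 : ∑ i, S i * star (S i) = 1)
    (ψ : A →ₗ[ℂ] ℂ)
    (hψ : ∀ μ ν : List (Fin n), ψ (cuntzWord S μ * star (cuntzWord S ν))
      = if μ = ν then (n : ℂ) ^ (-(μ.length : ℤ)) else 0) :
    ∀ α β μ ν : List (Fin n),
      ψ (cuntzWord S α * star (cuntzWord S β) * (cuntzWord S μ * star (cuntzWord S ν)))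
        = (n : ℂ) ^ ((μ.length : ℤ) - (ν.length : ℤ)) *
            ψ (cuntzWord S μ * star (cuntzWord S ν) *
              (cuntzWord S α * star (cuntzWord S β))) := by
  intro α β μ ν
  have hn0 : (n : ℂ) ≠ 0 := by
    exact_mod_cast (by omega : n ≠ 0)
  rw [map_cuntzWord_mul_star_mul hS1 ψ hψ, map_cuntzWord_mul_star_mul hS1 ψ hψ]
  have hiff : (∃ γ, (α = ν ++ γ ∧ β = μ ++ γ) ∨ (ν = α ++ γ ∧ μ = β ++ γ))
      ↔ ∃ γ, (μ = β ++ γ ∧ ν = α ++ γ) ∨ (β = μ ++ γ ∧ α = ν ++ γ) :=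
    exists_congr fun γ => by tauto
  by_cases h : ∃ γ, (μ = β ++ γ ∧ ν = α ++ γ) ∨ (β = μ ++ γ ∧ α = ν ++ γ)
  · rw [if_pos h, if_pos (hiff.mpr h), ← zpow_add₀ hn0]
    congr 1
    obtain ⟨γ, ⟨rfl, rfl⟩ | ⟨rfl, rfl⟩⟩ := h <;> simp only [List.length_append] <;> omega
  · rw [if_neg h, if_neg (hiff.not.mpr h), mul_zero]
end

section
/- For every real s > 1 the family ((1 + k²)^{-s/2})_{k ∈ ℤ} is summable, and (s − 1)·Σ_{k∈ℤ} (1 + k²)^{-s/2} tends to 2 as s tends to 1 from the right. -/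
/-- `((n + 1)²)^{-s/2} = 1 / (n + 1)^s`. -/
lemma sq_succ_rpow_neg_half (n : ℕ) (s : ℝ) :
    (((n : ℝ) + 1) ^ 2) ^ (-(s / 2)) = 1 / ((n + 1 : ℕ) : ℝ) ^ s := by
  have h : (0 : ℝ) ≤ (n : ℝ) + 1 := by positivity
  rw [← Real.rpow_natCast, ← Real.rpow_mul h, one_div, ← Real.rpow_neg (by positivity)]
  push_cast
  congr 1
  ring

lemma one_div_succ_rpow_le (n : ℕ) {s : ℝ} (hs : 0 ≤ s) :
    1 / ((n + 1 : ℕ) : ℝ) ^ s ≤ (1 + (n : ℝ) ^ 2) ^ (-(s / 2)) := by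
  rw [← sq_succ_rpow_neg_half]
  apply Real.rpow_le_rpow_of_nonpos (by positivity) _ (by linarith)
  nlinarith [(n.cast_nonneg : (0 : ℝ) ≤ n)]

lemma one_add_sq_succ_rpow_le (n : ℕ) {s : ℝ} (hs : 0 ≤ s) :
    (1 + ((n + 1 : ℕ) : ℝ) ^ 2) ^ (-(s / 2)) ≤ 1 / ((n + 1 : ℕ) : ℝ) ^ s := by
  rw [← sq_succ_rpow_neg_half]
  apply Real.rpow_le_rpow_of_nonpos (by positivity) _ (by linarith)
  push_cast
  linarith

lemma summable_nat_one_add_sq_rpow {s : ℝ} (hs : 1 < s) :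
    Summable (fun n : ℕ => (1 + (n : ℝ) ^ 2) ^ (-(s / 2))) := by
  refine (summable_nat_add_iff 1).mp ?_
  exact Summable.of_nonneg_of_le (fun n => by positivity)
    (fun n => one_add_sq_succ_rpow_le n (by linarith))
    ((summable_nat_add_iff 1).mpr (Real.summable_one_div_nat_rpow.mpr hs))

lemma tsum_one_div_succ_rpow {s : ℝ} (hs : 1 < s) :
    ∑' n : ℕ, 1 / ((n + 1 : ℕ) : ℝ) ^ s = ∑' n : ℕ, 1 / (n : ℝ) ^ s := by
  rw [(Real.summable_one_div_nat_rpow.mpr hs).tsum_eq_zero_add]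
  simp [Real.zero_rpow (by linarith : s ≠ 0)]

lemma tsum_one_div_rpow_le_tsum_one_add_sq {s : ℝ} (hs : 1 < s) :
    ∑' n : ℕ, 1 / (n : ℝ) ^ s ≤ ∑' n : ℕ, (1 + (n : ℝ) ^ 2) ^ (-(s / 2)) := by
  rw [← tsum_one_div_succ_rpow hs]
  exact ((summable_nat_add_iff 1).mpr (Real.summable_one_div_nat_rpow.mpr hs)).tsum_le_tsum
    (fun n => one_div_succ_rpow_le n (by linarith)) (summable_nat_one_add_sq_rpow hs)

lemma tsum_one_add_sq_le_one_add_tsum_one_div_rpow {s : ℝ} (hs : 1 < s) :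
    ∑' n : ℕ, (1 + (n : ℝ) ^ 2) ^ (-(s / 2)) ≤ 1 + ∑' n : ℕ, 1 / (n : ℝ) ^ s := by
  have hsum := summable_nat_one_add_sq_rpow hs
  rw [← tsum_one_div_succ_rpow hs, hsum.tsum_eq_zero_add]
  refine add_le_add (by simp) ?_
  exact ((summable_nat_add_iff 1).mpr hsum).tsum_le_tsum
    (fun n => one_add_sq_succ_rpow_le n (by linarith))
    ((summable_nat_add_iff 1).mpr (Real.summable_one_div_nat_rpow.mpr hs))

lemma hasSum_int_one_add_sq_rpow {s : ℝ} (hs : 1 < s) :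
    HasSum (fun k : ℤ => (1 + (k : ℝ) ^ 2) ^ (-(s / 2)))
      (2 * ∑' n : ℕ, (1 + (n : ℝ) ^ 2) ^ (-(s / 2)) - 1) := by
  have h := (summable_nat_one_add_sq_rpow hs).hasSum
  have := HasSum.of_nat_of_neg (f := fun k : ℤ => (1 + (k : ℝ) ^ 2) ^ (-(s / 2)))
    (by simpa using h) (by simpa using h)
  simpa [two_mul] using this

/-- for every real `s > 1` the family `((1 + k²)^{-s/2})_{k ∈ ℤ}` is summable,
and `(s - 1) · ∑_{k ∈ ℤ} (1 + k²)^{-s/2} → 2` as `s → 1⁺`. -/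
theorem stmt_3 :
    (∀ s : ℝ, 1 < s → Summable (fun k : ℤ => (1 + (k : ℝ) ^ 2) ^ (-(s / 2)))) ∧
    Filter.Tendsto (fun s : ℝ => (s - 1) * ∑' k : ℤ, (1 + (k : ℝ) ^ 2) ^ (-(s / 2)))
      (nhdsWithin 1 (Set.Ioi 1)) (nhds 2) := by
  refine ⟨fun s hs => (hasSum_int_one_add_sq_rpow hs).summable, ?_⟩
  have hz := tendsto_sub_mul_tsum_nat_rpow.const_mul 2
  have hl : Filter.Tendsto (fun s : ℝ => s - 1) (nhdsWithin 1 (Set.Ioi 1)) (nhds 0) :=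
    ((continuous_sub_right (1 : ℝ)).tendsto' 1 0 (sub_self 1)).mono_left nhdsWithin_le_nhds
  have hlo := hz.sub hl
  have hhi := hz.add hl
  norm_num only at hlo hhi
  refine tendsto_of_tendsto_of_tendsto_of_le_of_le' hlo hhi ?_ ?_ <;>
  · filter_upwards [self_mem_nhdsWithin] with s hs
    have hs : 1 < s := hs
    rw [(hasSum_int_one_add_sq_rpow hs).tsum_eq]
    nlinarith [tsum_one_div_rpow_le_tsum_one_add_sq hs,
      tsum_one_add_sq_le_one_add_tsum_one_div_rpow hs]
end

section
/- Let v ∈ A be a partial isometry (v v* v = v) with v*v, vv* ∈ F and v·σ(v*), v*·σ(v) ∈ F. Then the modular unitaries u_v = [[1 − v*v, v*],[v, 1 − vv*]] and u_{v*} = [[1 − vv*, v],[v*, 1 − v*v]] are modular homotopic in M₂(A). In particular, for a Cuntz family with v = S_μ S_ν*, the unitaries u_{μ,ν} = [[1 − P_μ, S_μ S_ν*],[S_ν S_μ*, 1 − P_ν]] and u_{ν,μ} are modular homotopic. -/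
open Matrix

/-- `u ∈ M_m(A)` is a modular unitary with respect to the automorphism `σ`:
it is unitary and both `u σ(u^*)` and `u^* σ(u)` have all entries fixed by `σ`
(i.e. lie in the fixed-point algebra `F`), where `σ` acts entrywise. -/
def IsModularUnitary {A : Type*} [Ring A] [StarRing A] (σ : A → A)
    {m : Type*} [Fintype m] [DecidableEq m] (u : Matrix m m A) : Prop :=
  u * star u = 1 ∧ star u * u = 1 ∧
  (∀ i j, σ ((u * (star u).map σ) i j) = (u * (star u).map σ) i j) ∧
  (∀ i j, σ ((star u * u.map σ) i j) = (star u * u.map σ) i j)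

section Conjugation

variable {A : Type*} [Ring A] [StarRing A] {m : Type*} [Fintype m] [DecidableEq m]

/-- Conjugating by a unitary `R` fixed entrywise by `σ` conjugates `u σ(u^*)` by `R`. -/
theorem conj_mul_map_star_conj (σ : A →+* A) {R u : Matrix m m A} (hR : star R * R = 1)
    (hσ : R.map σ = R) (hσ' : (star R).map σ = star R) :
    (R * u * star R) * (star (R * u * star R)).map σ = R * (u * (star u).map σ) * star R := by
  simp only [star_mul, star_star, Matrix.map_mul, hσ, hσ', mul_assoc]
  rw [← mul_assoc (star R) R, hR, one_mul]

/-- Conjugating by a unitary `R` fixed entrywise by `σ` conjugates `u^* σ(u)` by `R`. -/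
theorem star_conj_mul_map_conj (σ : A →+* A) {R u : Matrix m m A} (hR : star R * R = 1)
    (hσ : R.map σ = R) (hσ' : (star R).map σ = star R) :
    star (R * u * star R) * (R * u * star R).map σ = R * (star u * u.map σ) * star R := by
  simp only [star_mul, star_star, Matrix.map_mul, hσ, hσ', mul_assoc]
  rw [← mul_assoc (star R) R, hR, one_mul]

/-- Modular unitaries are stable under conjugation by unitaries fixed entrywise by `σ`. -/
theorem IsModularUnitary.conj {σ : A →+* A} {R u : Matrix m m A} (hu : IsModularUnitary σ u)
    (hR : star R * R = 1) (hR' : R * star R = 1)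
    (hσ : R.map σ = R) (hσ' : (star R).map σ = star R) :
    IsModularUnitary σ (R * u * star R) := by
  obtain ⟨hu₁, hu₂, hu₃, hu₄⟩ := hu
  have fixed {x : Matrix m m A} (hx : ∀ i j, σ (x i j) = x i j) (i j : m) :
      σ ((R * x * star R) i j) = (R * x * star R) i j := by
    have hx' : x.map σ = x := Matrix.ext hx
    have h : (R * x * star R).map σ = R * x * star R := by
      rw [Matrix.map_mul, Matrix.map_mul, hσ, hσ', hx']
    exact congrFun (congrFun h i) j
  refine ⟨?_, ?_, ?_, ?_⟩
  · calc R * u * star R * star (R * u * star R)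
        = R * (u * (star R * R) * star u) * star R := by
          simp only [star_mul, star_star, mul_assoc]
      _ = 1 := by rw [hR, mul_one, hu₁, mul_one, hR']
  · calc star (R * u * star R) * (R * u * star R)
        = R * (star u * (star R * R) * u) * star R := by
          simp only [star_mul, star_star, mul_assoc]
      _ = 1 := by rw [hR, mul_one, hu₂, mul_one, hR']
  · rw [conj_mul_map_star_conj σ hR hσ hσ']
    exact fixed hu₃
  · rw [star_conj_mul_map_conj σ hR hσ hσ']
    exact fixed hu₄

/-- The unitary `u_v` attached to a partial isometry `v`. -/
def partialIsometryUnitary (v : A) : Matrix (Fin 2) (Fin 2) A :=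
  !![1 - star v * v, star v; v, 1 - v * star v]

theorem star_partialIsometryUnitary (v : A) :
    star (partialIsometryUnitary v) = partialIsometryUnitary v := by
  ext i j
  fin_cases i <;> fin_cases j <;> simp [partialIsometryUnitary, Matrix.star_apply]

theorem partialIsometryUnitary_mul_map (σ : A →+* A) {v : A} (hv : v * star v * v = v)
    (h1 : σ (star v * v) = star v * v) (h2 : σ (v * star v) = v * star v) :
    partialIsometryUnitary v * (partialIsometryUnitary v).map σ =
      !![1 - star v * v + star v * σ v, 0; 0, v * σ (star v) + (1 - v * star v)] := by
  have hv' : star v * v * star v = star v := by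
    simpa [mul_assoc] using congrArg star hv
  have hp : (1 - star v * v) * (1 - star v * v) = 1 - star v * v := by
    have : star v * v * (star v * v) = star v * v := by rw [← mul_assoc, hv']
    simp [mul_sub, sub_mul, this]
  have hq : (1 - v * star v) * (1 - v * star v) = 1 - v * star v := by
    have : v * star v * (v * star v) = v * star v := by rw [← mul_assoc, hv]
    simp [mul_sub, sub_mul, this]
  have hp' : (1 - star v * v) * σ (star v) = 0 := by
    rw [sub_mul, one_mul, ← h1, ← map_mul, hv', sub_self]
  have hq' : (1 - v * star v) * σ v = 0 := by
    rw [sub_mul, one_mul, ← h2, ← map_mul, hv, sub_self]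
  have hr : star v * (1 - v * star v) = 0 := by
    rw [mul_sub, mul_one, ← mul_assoc, hv', sub_self]
  have hs : v * (1 - star v * v) = 0 := by
    rw [mul_sub, mul_one, ← mul_assoc, hv, sub_self]
  have h1' : σ (1 - star v * v) = 1 - star v * v := by rw [map_sub, map_one, h1]
  have h2' : σ (1 - v * star v) = 1 - v * star v := by rw [map_sub, map_one, h2]
  ext i j
  fin_cases i <;> fin_cases j <;>
    simp only [partialIsometryUnitary, Matrix.mul_apply, Fin.sum_univ_two, Matrix.map_apply,
      Fin.zero_eta, Fin.mk_one, Matrix.of_apply, Matrix.cons_val_zero, Matrix.cons_val_one,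
      Matrix.cons_val', Matrix.cons_val_fin_one, h1', h2', hp, hq, hp', hq', hr, hs, add_zero]

theorem isModularUnitary_partialIsometryUnitary (σ : A →+* A) {v : A}
    (hv : v * star v * v = v)
    (h1 : σ (star v * v) = star v * v) (h2 : σ (v * star v) = v * star v)
    (h3 : σ (v * σ (star v)) = v * σ (star v)) (h4 : σ (star v * σ v) = star v * σ v) :
    IsModularUnitary σ (partialIsometryUnitary v) := by
  have hsq : partialIsometryUnitary v * partialIsometryUnitary v = 1 := by
    have h := partialIsometryUnitary_mul_map (RingHom.id A) hv rfl rfl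
    rw [show (partialIsometryUnitary v).map (RingHom.id A) = partialIsometryUnitary v from rfl]
      at h
    rw [h, Matrix.one_fin_two]
    simp
  have fixed (i j : Fin 2) :
      σ ((partialIsometryUnitary v * (partialIsometryUnitary v).map σ) i j) =
        (partialIsometryUnitary v * (partialIsometryUnitary v).map σ) i j := by
    rw [partialIsometryUnitary_mul_map σ hv h1 h2]
    fin_cases i <;> fin_cases j <;>
      simp only [Fin.zero_eta, Fin.mk_one, Matrix.of_apply, Matrix.cons_val_zero,
        Matrix.cons_val_one, Matrix.cons_val', Matrix.cons_val_fin_one, map_add, map_sub,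
        map_one, map_zero, h1, h2, h3, h4]
  simp only [IsModularUnitary, star_partialIsometryUnitary]
  exact ⟨hsq, hsq, fixed, fixed⟩

end Conjugation

/-- A path of unitary scalar matrices from the identity (at `0`) to the swap matrix (at `1`),
with eigenvalues `1` and `exp (π i t)`. -/
noncomputable def swapPath (t : ℝ) : Matrix (Fin 2) (Fin 2) ℂ :=
  !![(1 + Complex.exp (t * Real.pi * Complex.I)) / 2,
      (1 - Complex.exp (t * Real.pi * Complex.I)) / 2;
    (1 - Complex.exp (t * Real.pi * Complex.I)) / 2,
      (1 + Complex.exp (t * Real.pi * Complex.I)) / 2]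

theorem continuous_swapPath : Continuous swapPath := by
  refine continuous_matrix fun i j => ?_
  fin_cases i <;> fin_cases j <;> simp [swapPath] <;> fun_prop

theorem swapPath_zero : swapPath 0 = 1 := by
  simp [swapPath, Matrix.one_fin_two]

theorem swapPath_one : swapPath 1 = !![0, 1; 1, 0] := by
  simp [swapPath, Complex.exp_pi_mul_I]

theorem swapPath_mul_star (t : ℝ) : swapPath t * star (swapPath t) = 1 := by
  have hz : Complex.exp (t * Real.pi * Complex.I) *
      star (Complex.exp (t * Real.pi * Complex.I)) = 1 := by
    rw [Complex.star_def, Complex.mul_conj, Complex.normSq_eq_norm_sq, ← Complex.ofReal_mul,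
      Complex.norm_exp_ofReal_mul_I]
    simp
  unfold swapPath
  generalize Complex.exp (t * Real.pi * Complex.I) = z at hz
  rw [Complex.star_def] at hz
  have h_two : (starRingEnd ℂ) 2 = 2 := map_ofNat _ 2
  ext i j
  fin_cases i <;> fin_cases j <;>
    simp [Matrix.mul_apply, Fin.sum_univ_two, Matrix.star_apply, h_two] <;> grind

/-- for a partial isometry `v` with `v*v, vv* ∈ F` and
`v σ(v*), v* σ(v) ∈ F`, the modular unitaries
`u_v = [[1 - v*v, v*],[v, 1 - vv*]]` and `u_{v*} = [[1 - vv*, v],[v*, 1 - v*v]]`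
are modular homotopic in `M₂(A)`.  (Applied to `v = S_μ S_ν^*` in a Cuntz algebra this
gives the modular homotopy `u_{μ,ν} ∼ u_{ν,μ}`.) -/
theorem stmt_11 {A : Type*} [NormedRing A] [StarRing A] [CStarRing A]
    [NormedAlgebra ℂ A] [CompleteSpace A] [StarModule ℂ A]
    (σ : A ≃ₐ[ℂ] A) (hreg : ∀ a : A, star (σ a) = σ.symm (star a))
    (v : A) (hv : v * star v * v = v)
    (h1 : σ (star v * v) = star v * v) (h2 : σ (v * star v) = v * star v)
    (h3 : σ (v * σ (star v)) = v * σ (star v)) (h4 : σ (star v * σ v) = star v * σ v) :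
    ∃ w : ℝ → Matrix (Fin 2) (Fin 2) A,
      ContinuousOn w (Set.Icc (0 : ℝ) 1) ∧
      w 0 = !![1 - star v * v, star v; v, 1 - v * star v] ∧
      w 1 = !![1 - v * star v, v; star v, 1 - star v * v] ∧
      (∀ t ∈ Set.Icc (0 : ℝ) 1, IsModularUnitary (⇑σ) (w t)) ∧
      ContinuousOn (fun t => w t * (star (w t)).map (⇑σ)) (Set.Icc (0 : ℝ) 1) ∧
      ContinuousOn (fun t => star (w t) * (w t).map (⇑σ)) (Set.Icc (0 : ℝ) 1) := by
  let ρ : A →+* A := σ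
  let ι : ℂ →+* A := algebraMap ℂ A
  let R : ℝ → Matrix (Fin 2) (Fin 2) A := fun t => (swapPath t).map ι
  let u := partialIsometryUnitary v
  have hstar (t : ℝ) : star (R t) = (star (swapPath t)).map ι := by
    ext i j
    exact (algebraMap_star_comm _).symm
  have hRR (t : ℝ) : R t * star (R t) = 1 := by
    rw [hstar, ← Matrix.map_mul, swapPath_mul_star, Matrix.map_one _ (map_zero _) (map_one _)]
  have hRR' (t : ℝ) : star (R t) * R t = 1 := by
    rw [hstar, ← Matrix.map_mul, mul_eq_one_comm.mp (swapPath_mul_star t),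
      Matrix.map_one _ (map_zero _) (map_one _)]
  have hfix (x : Matrix (Fin 2) (Fin 2) ℂ) : (x.map ι).map ρ = x.map ι := by
    ext i j
    exact σ.commutes _
  have hσ (t : ℝ) : (R t).map ρ = R t := hfix _
  have hσ' (t : ℝ) : (star (R t)).map ρ = star (R t) := by rw [hstar, hfix]
  have hR : Continuous R := continuous_swapPath.matrix_map (continuous_algebraMap ℂ A)
  have hconj (x : Matrix (Fin 2) (Fin 2) A) : Continuous fun t => R t * x * star (R t) :=
    (hR.mul continuous_const).mul hR.star
  have hu : IsModularUnitary ρ u := isModularUnitary_partialIsometryUnitary ρ hv h1 h2 h3 h4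
  refine ⟨fun t => R t * u * star (R t), (hconj u).continuousOn, ?_, ?_,
    fun t _ => hu.conj (hRR' t) (hRR t) (hσ t) (hσ' t), ?_, ?_⟩
  · have h : R 0 = 1 := by
      simp only [R, swapPath_zero, Matrix.map_one _ (map_zero ι) (map_one ι)]
    simp only [h, star_one, one_mul, mul_one]
    rfl
  · have h : R 1 = !![0, 1; 1, 0] := by
      ext i j
      fin_cases i <;> fin_cases j <;> simp [R, swapPath_one]
    simp only [h]
    ext i j
    fin_cases i <;> fin_cases j <;>
      simp [u, partialIsometryUnitary, Matrix.mul_apply, Fin.sum_univ_two, Matrix.star_apply]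
  · exact ((hconj (u * (star u).map ρ)).congr fun t =>
      (conj_mul_map_star_conj ρ (hRR' t) (hσ t) (hσ' t)).symm).continuousOn
  · exact ((hconj (star u * u.map ρ)).congr fun t =>
      (star_conj_mul_map_conj ρ (hRR' t) (hσ t) (hσ' t)).symm).continuousOn
end

section
/- Let A be a unital complex algebra, σ an algebra automorphism of A, δ : A → A a derivation, and ψ : A → ℂ a linear functional satisfying the KMS condition ψ(xy) = ψ(σ(y)·x) for all x, y ∈ A, together with ψ(δ(a)) = 0 for all a ∈ A. Define θ : A × A → ℂ by θ(a₀, a₁) = ψ(a₀·δ(a₁)). Then θ is a σ-twisted (b,B)-cocycle: for all a₀, a₁, a₂ ∈ A, θ(a₀a₁, a₂) − θ(a₀, a₁a₂) + θ(σ(a₂)a₀, a₁) = 0, and θ(1, a₀) = 0 for all a₀ ∈ A. -/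
/-- if `ψ` satisfies the KMS condition `ψ(xy) = ψ(σ(y)x)` and kills the
derivation `δ`, then `θ(a₀,a₁) = ψ(a₀ δ(a₁))` is a `σ`-twisted (b,B)-cocycle:
`θ(a₀a₁,a₂) - θ(a₀,a₁a₂) + θ(σ(a₂)a₀,a₁) = 0` and `θ(1,a₀) = 0`. -/
theorem stmt_13 {A : Type*} [Ring A] [Algebra ℂ A]
    (σ : A ≃ₐ[ℂ] A) (δ : A →ₗ[ℂ] A)
    (hder : ∀ a b : A, δ (a * b) = δ a * b + a * δ b)
    (ψ : A →ₗ[ℂ] ℂ)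
    (hkms : ∀ x y : A, ψ (x * y) = ψ (σ y * x))
    (hδ : ∀ a : A, ψ (δ a) = 0) :
    (∀ a₀ a₁ a₂ : A,
      ψ (a₀ * a₁ * δ a₂) - ψ (a₀ * δ (a₁ * a₂)) + ψ (σ a₂ * a₀ * δ a₁) = 0) ∧
    (∀ a₀ : A, ψ (1 * δ a₀) = 0) := by
  refine ⟨fun a₀ a₁ a₂ => ?_, fun a₀ => by rw [one_mul, hδ]⟩
  rw [hder, mul_add, map_add, mul_assoc (σ a₂), ← hkms, mul_assoc a₀ a₁, mul_assoc a₀ (δ a₁)]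
  ring
end

section
/- Let v ∈ A be a partial isometry (v v* v = v) with v*v ∈ F and vv* ∈ F, and set u_v = [[1 − v*v, v*],[v, 1 − vv*]] ∈ M₂(A). Then 1 − σ(u_v*)·u_v = [[v*v − σ(v*)v, 0],[0, vv* − σ(v)v*]] in M₂(A). Consequently, if ψ : A → ℂ is a linear functional satisfying ψ(xy) = ψ(σ(y)·x) for all x, y ∈ A, then ψ(v*v − σ(v*)v) + ψ(vv* − σ(v)v*) = 0. -/
/-- for a partial isometry `v` with `v*v, vv* ∈ F`, one has
`1 - σ(u_v^*) u_v = [[v*v - σ(v*)v, 0],[0, vv* - σ(v)v*]]` in `M₂(A)`; consequently,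
for any linear functional `ψ` with `ψ(xy) = ψ(σ(y)x)`,
`ψ(v*v - σ(v*)v) + ψ(vv* - σ(v)v*) = 0`. -/
theorem stmt_17 {A : Type*} [Ring A] [Algebra ℂ A] [StarRing A] [StarModule ℂ A]
    (σ : A ≃ₐ[ℂ] A) (hreg : ∀ a : A, star (σ a) = σ.symm (star a))
    (v : A) (hv : v * star v * v = v)
    (h1 : σ (star v * v) = star v * v) (h2 : σ (v * star v) = v * star v) :
    ∀ u : Matrix (Fin 2) (Fin 2) A,
      u = !![1 - star v * v, star v; v, 1 - v * star v] →
      ((1 : Matrix (Fin 2) (Fin 2) A) - (star u).map (⇑σ) * u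
        = !![star v * v - σ (star v) * v, 0; 0, v * star v - σ v * star v]) ∧
      (∀ ψ : A →ₗ[ℂ] ℂ, (∀ x y : A, ψ (x * y) = ψ (σ y * x)) →
        ψ (star v * v - σ (star v) * v) + ψ (v * star v - σ v * star v) = 0) := by
  rintro u rfl
  have hv' : star v * v * star v = star v := by
    simpa [mul_assoc] using congrArg star hv
  have h1' : σ (star v) * σ v = star v * v := by rw [← map_mul, h1]
  have h2' : σ v * σ (star v) = v * star v := by rw [← map_mul, h2]
  refine ⟨?_, fun ψ hψ => ?_⟩
  · have e00 : (1 - star v * v) * (1 - star v * v) = 1 - star v * v := by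
      have h : star v * v * (star v * v) = star v * v := by rw [← mul_assoc, hv']
      rw [mul_sub, sub_mul, sub_mul, h]; simp
    have e11 : (1 - v * star v) * (1 - v * star v) = 1 - v * star v := by
      have h : v * star v * (v * star v) = v * star v := by rw [← mul_assoc, hv]
      rw [mul_sub, sub_mul, sub_mul, h]; simp
    have e01 : (1 - star v * v) * star v = 0 := by rw [sub_mul, hv', one_mul, sub_self]
    have e10 : (1 - v * star v) * v = 0 := by rw [sub_mul, hv, one_mul, sub_self]
    have f01 : σ (star v) * (1 - v * star v) = 0 := by
      rw [← h2, mul_sub, ← map_mul, ← mul_assoc, hv', mul_one, sub_self]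
    have f10 : σ v * (1 - star v * v) = 0 := by
      rw [← h1, mul_sub, ← map_mul, ← mul_assoc, hv, mul_one, sub_self]
    ext i j
    fin_cases i <;> fin_cases j <;>
      simp [Matrix.mul_apply, Fin.sum_univ_two, Matrix.star_apply, h1', h2',
        e00, e11, e01, e10, f01, f10] <;> abel
  · rw [map_sub, map_sub, ← hψ, ← hψ]
    ring
end
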